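/- Clipped change-of-measure decomposition: Let Z be a countable set, let p and μ be probability mass functions on Z, let γ > 0, and let g : Z → ℝ satisfy |g(z)| ≤ 1 for all z ∈ Z. Then ∑_{z∈Z} p(z)·g(z) ≤ ∑_{z∈Z} μ(z)·g(z)·min{ p(z)/μ(z), γ } + 2·∑_{z∈Z} p(z)·1{ p(z) > γ·μ(z) }, where summands in the middle sum with μ(z) = 0 are interpreted as 0. (Applying this to −g yields the symmetric inequality for ∑_z p(z)·(−g(z)).) -/

import Mathlib

open scoped BigOperators

/-- A probability mass function on a countable set: nonnegative and sums to 1. -/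
def IsPMF {Z : Type*} (p : Z → ℝ) : Prop :=
  (∀ z, 0 ≤ p z) ∧ HasSum p 1

/-- Clipping the ratio `a / b` at scale `c` and multiplying back by `b` gives `min a (c * b)`. -/
theorem mul_min_div_eq_min {a b c : ℝ} (ha : 0 ≤ a) (hb : 0 ≤ b) :
    b * min (a / b) c = min a (c * b) := by
  rcases hb.eq_or_lt with rfl | hb
  · simp [ha]
  · rw [mul_min_of_nonneg _ _ hb.le, mul_div_cancel₀ _ hb.ne', mul_comm b c]

/-- Clipped change-of-measure decomposition: for `|g| ≤ 1`,
`∑_z p(z)·g(z) ≤ ∑_z μ(z)·g(z)·min{p(z)/μ(z), γ} + 2·∑_z p(z)·1{p(z) > γ·μ(z)}`. -/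
theorem clipped_change_of_measure
    {Z : Type*} [Countable Z] (p μ : Z → ℝ) (γ : ℝ) (hγ : 0 < γ)
    (hp : IsPMF p) (hμ : IsPMF μ)
    (g : Z → ℝ) (hg : ∀ z, |g z| ≤ 1) :
    ∑' z, p z * g z
      ≤ (∑' z, μ z * g z * min (p z / μ z) γ)
        + 2 * ∑' z, p z * (if γ * μ z < p z then (1 : ℝ) else 0) := by
  have hclip (z : Z) : μ z * g z * min (p z / μ z) γ = min (p z) (γ * μ z) * g z := by
    rw [← mul_min_div_eq_min (hp.1 z) (hμ.1 z)]
    ring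
  have hmin_nonneg (z : Z) : 0 ≤ min (p z) (γ * μ z) :=
    le_min (hp.1 z) (mul_nonneg hγ.le (hμ.1 z))
  have hsummable_left : Summable fun z => p z * g z := by
    refine .of_norm_bounded hp.2.summable fun z => ?_
    rw [norm_mul, Real.norm_of_nonneg (hp.1 z)]
    exact mul_le_of_le_one_right (hp.1 z) (hg z)
  have hsummable_clip : Summable fun z => μ z * g z * min (p z / μ z) γ := by
    refine .of_norm_bounded hp.2.summable fun z => ?_
    rw [hclip, norm_mul, Real.norm_of_nonneg (hmin_nonneg z)]
    exact (mul_le_of_le_one_right (hmin_nonneg z) (hg z)).trans (min_le_left _ _)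
  have hsummable_tail :
      Summable fun z => p z * (if γ * μ z < p z then (1 : ℝ) else 0) := by
    refine .of_nonneg_of_le (fun z => ?_) (fun z => ?_) hp.2.summable
    · exact mul_nonneg (hp.1 z) (by split_ifs <;> norm_num)
    · exact mul_le_of_le_one_right (hp.1 z) (by split_ifs <;> norm_num)
  rw [← tsum_mul_left, ← hsummable_clip.tsum_add (hsummable_tail.mul_left 2)]
  refine hsummable_left.tsum_le_tsum (fun z => ?_)
    (hsummable_clip.add (hsummable_tail.mul_left 2))
  rw [hclip]
  have hgz := (abs_le.mp (hg z)).2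
  have hpz := hp.1 z
  have hμz := mul_nonneg hγ.le (hμ.1 z)
  split_ifs with h
  · rw [min_eq_right h.le]
    nlinarith [mul_nonneg (sub_nonneg.mpr h.le) (sub_nonneg.mpr hgz)]
  · rw [min_eq_left (not_lt.mp h)]
    simp
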